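/- arXiv:1308.4624 — 3 statements merged into one kernel-verified Lean document; each statement's English description precedes it below -/
import Mathlib

section
/- Every n×n matrix X over a field F is B-equivalent to a unique sub-permutation (0,1)-matrix; that is, there exists exactly one sub-permutation (0,1)-matrix Y such that Y = h'Xk for some invertible upper triangular matrices h, k. -/
open Matrix

variable {F : Type*} [Field F] {n : ℕ}

/-- Membership in `B`: invertible upper triangular matrices. -/
def InB (h : Matrix (Fin n) (Fin n) F) : Prop :=
  IsUnit h.det ∧ ∀ i j : Fin n, j < i → h i j = 0

/-- A sub-permutation matrix: at most one nonzero entry in every row and column. -/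
def SubPerm (Y : Matrix (Fin n) (Fin n) F) : Prop :=
  (∀ i j k : Fin n, Y i j ≠ 0 → Y i k ≠ 0 → j = k) ∧
  (∀ i j k : Fin n, Y i k ≠ 0 → Y j k ≠ 0 → i = j)

/-- A (0,1)-matrix: every entry is 0 or 1. -/
def ZeroOne (Y : Matrix (Fin n) (Fin n) F) : Prop :=
  ∀ i j, Y i j = 0 ∨ Y i j = 1

theorem InB.one : InB (1 : Matrix (Fin n) (Fin n) F) :=
  ⟨by simp, fun _ _ hij => Matrix.one_apply_ne hij.ne'⟩

theorem InB.mul {h k : Matrix (Fin n) (Fin n) F} (hh : InB h) (hk : InB k) : InB (h * k) :=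
  ⟨by rw [Matrix.det_mul]; exact hh.1.mul hk.1,
    Matrix.BlockTriangular.mul (b := id) (fun i j => hh.2 i j) (fun i j => hk.2 i j)⟩

theorem InB.inv {h : Matrix (Fin n) (Fin n) F} (hh : InB h) : InB h⁻¹ := by
  have := Matrix.invertibleOfIsUnitDet h hh.1
  have hT : Matrix.BlockTriangular h id := fun i j => hh.2 i j
  exact ⟨Matrix.isUnit_nonsing_inv_det h hh.1,
    Matrix.blockTriangular_inv_of_blockTriangular hT⟩

theorem InB.diag_ne_zero {h : Matrix (Fin n) (Fin n) F} (hh : InB h) (i : Fin n) :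
    h i i ≠ 0 := by
  have hdet := hh.1.ne_zero
  rw [Matrix.det_of_isUpperTriangular (fun i j => hh.2 i j)] at hdet
  exact Finset.prod_ne_zero_iff.mp hdet i (Finset.mem_univ i)

theorem InB.of_diag_ne_zero {h : Matrix (Fin n) (Fin n) F} (hd : ∀ i, h i i ≠ 0)
    (hT : ∀ i j : Fin n, j < i → h i j = 0) : InB h := by
  refine ⟨?_, hT⟩
  rw [Matrix.det_of_isUpperTriangular (fun i j => hT i j), isUnit_iff_ne_zero]
  exact Finset.prod_ne_zero_iff.mpr fun i _ => hd i

/-- `B`-equivalence of matrices. -/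
def BEquiv (X Y : Matrix (Fin n) (Fin n) F) : Prop :=
  ∃ h k : Matrix (Fin n) (Fin n) F, InB h ∧ InB k ∧ Y = hᵀ * X * k

theorem BEquiv.refl (X : Matrix (Fin n) (Fin n) F) : BEquiv X X :=
  ⟨1, 1, InB.one, InB.one, by simp⟩

theorem BEquiv.trans {X Y Z : Matrix (Fin n) (Fin n) F} (hXY : BEquiv X Y)
    (hYZ : BEquiv Y Z) : BEquiv X Z := by
  obtain ⟨h, k, hh, hk, rfl⟩ := hXY
  obtain ⟨h', k', hh', hk', rfl⟩ := hYZ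
  exact ⟨h * h', k * k', hh.mul hh', hk.mul hk', by
    simp only [Matrix.transpose_mul, Matrix.mul_assoc]⟩

theorem BEquiv.symm {X Y : Matrix (Fin n) (Fin n) F} (hXY : BEquiv X Y) : BEquiv Y X := by
  obtain ⟨h, k, hh, hk, rfl⟩ := hXY
  refine ⟨h⁻¹, k⁻¹, hh.inv, hk.inv, ?_⟩
  have hl : (h⁻¹)ᵀ * hᵀ = 1 := by
    rw [← Matrix.transpose_mul, Matrix.mul_nonsing_inv h hh.1, Matrix.transpose_one]
  calc X = ((h⁻¹)ᵀ * hᵀ) * X * (k * k⁻¹) := by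
        rw [hl, Matrix.mul_nonsing_inv k hk.1, Matrix.one_mul, Matrix.mul_one]
    _ = (h⁻¹)ᵀ * (hᵀ * X * k) * k⁻¹ := by simp only [Matrix.mul_assoc]

theorem SubPerm.exists_le_ne_zero {Y Z : Matrix (Fin n) (Fin n) F} (hY : SubPerm Y)
    (hYZ : BEquiv Y Z) {i j : Fin n} (hij : Y i j ≠ 0) : ∃ l ≤ j, Z i l ≠ 0 := by
  obtain ⟨h, k, hh, hk, rfl⟩ := hYZ
  by_contra! hzero
  have hcancel : (hᵀ * Y * k) * k⁻¹ = hᵀ * Y := by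
    rw [Matrix.mul_assoc, Matrix.mul_nonsing_inv k hk.1, Matrix.mul_one]
  have hleft : ((hᵀ * Y * k) * k⁻¹) i j = 0 := by
    rw [Matrix.mul_apply]
    refine Finset.sum_eq_zero fun l _ => ?_
    rcases le_or_gt l j with hl | hl
    · rw [hzero l hl, zero_mul]
    · rw [hk.inv.2 l j hl, mul_zero]
  have hright : (hᵀ * Y) i j = h i i * Y i j := by
    rw [Matrix.mul_apply, Finset.sum_eq_single i]
    · rfl
    · intro a _ ha
      by_contra hne
      exact ha (hY.2 a i j (right_ne_zero_of_mul hne) hij)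
    · simp
  rw [hcancel, hright] at hleft
  exact mul_ne_zero (hh.diag_ne_zero i) hij hleft

theorem SubPerm.ne_zero_of_bEquiv {Y Z : Matrix (Fin n) (Fin n) F} (hY : SubPerm Y)
    (hZ : SubPerm Z) (hYZ : BEquiv Y Z) {i j : Fin n} (hij : Y i j ≠ 0) : Z i j ≠ 0 := by
  obtain ⟨l, hl, hZl⟩ := hY.exists_le_ne_zero hYZ hij
  obtain ⟨m, hm, hYm⟩ := hZ.exists_le_ne_zero hYZ.symm hZl
  obtain rfl := hY.1 i j m hij hYm
  rwa [le_antisymm hm hl]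

theorem eq_of_bEquiv {Y Z : Matrix (Fin n) (Fin n) F} (hY : SubPerm Y) (hY' : ZeroOne Y)
    (hZ : SubPerm Z) (hZ' : ZeroOne Z) (hYZ : BEquiv Y Z) : Y = Z := by
  ext i j
  have h₁ := hY.ne_zero_of_bEquiv hZ hYZ (i := i) (j := j)
  have h₂ := hZ.ne_zero_of_bEquiv hY hYZ.symm (i := i) (j := j)
  rcases hY' i j with h | h <;> rcases hZ' i j with h' | h' <;> simp_all

/-- Every nonzero entry of row `i` is a `1` that is alone in its row and in its column. -/
def RowReduced (Y : Matrix (Fin n) (Fin n) F) (i : Fin n) : Prop :=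
  ∀ j, Y i j ≠ 0 → Y i j = 1 ∧ (∀ l, l ≠ j → Y i l = 0) ∧ ∀ a, a ≠ i → Y a j = 0

/-- The matrix obtained from `Y` by pivoting on the entry `(r, c)`. -/
def pivot (Y : Matrix (Fin n) (Fin n) F) (r c : Fin n) : Matrix (Fin n) (Fin n) F :=
  fun a b => if a = r then (if b = c then 1 else 0) else
    if b = c then 0 else Y a b - Y a c * Y r b / Y r c

theorem bEquiv_pivot {Y : Matrix (Fin n) (Fin n) F} {r c : Fin n} (hrc : Y r c ≠ 0)
    (hrow : ∀ b < c, Y r b = 0) (hcol : ∀ a < r, Y a c = 0) : BEquiv Y (pivot Y r c) := by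
  set v : Fin n → F := fun a => if a = r then (Y r c)⁻¹ - 1 else -Y a c / Y r c with hv
  set w : Fin n → F := fun b => if b = c then 0 else -Y r b / Y r c with hw
  refine ⟨1 + Matrix.vecMulVec (Pi.single r 1) v, 1 + Matrix.vecMulVec (Pi.single c 1) w,
    InB.of_diag_ne_zero (fun i => ?_) (fun i j hji => ?_),
    InB.of_diag_ne_zero (fun i => ?_) (fun i j hji => ?_), ?_⟩
  · by_cases hi : i = r <;> simp [Matrix.vecMulVec_apply, hv, hi, hrc]
  · by_cases hi : i = r
    · subst hi
      simp [Matrix.vecMulVec_apply, hv, hji.ne, hji.ne', hcol j hji]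
    · simp [Matrix.vecMulVec_apply, hi, hji.ne']
  · by_cases hi : i = c <;> simp [Matrix.vecMulVec_apply, hw, hi]
  · by_cases hi : i = c
    · subst hi
      simp [Matrix.vecMulVec_apply, hw, hji.ne, hji.ne', hrow j hji]
    · simp [Matrix.vecMulVec_apply, hi, hji.ne']
  · ext a b
    have hentry : ((1 + Matrix.vecMulVec (Pi.single r 1) v)ᵀ * Y *
        (1 + Matrix.vecMulVec (Pi.single c 1) w) : Matrix (Fin n) (Fin n) F) a b =
        Y a b + v a * Y r b + (Y a c + v a * Y r c) * w b := by
      simp [Matrix.transpose_vecMulVec, Matrix.add_mul, Matrix.mul_add,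
        Matrix.vecMulVec_mul, Matrix.mul_vecMulVec, Matrix.vecMulVec_apply]
    rw [hentry]
    simp only [pivot, hv, hw]
    split_ifs <;> subst_vars <;> field_simp <;> ring

theorem exists_bEquiv_rowReduced (X : Matrix (Fin n) (Fin n) F) (r : ℕ) :
    ∃ Y, BEquiv X Y ∧ ∀ i : Fin n, (i : ℕ) < r → RowReduced Y i := by
  induction r with
  | zero => exact ⟨X, BEquiv.refl X, by simp⟩
  | succ r ih =>
    obtain ⟨Y, hXY, hY⟩ := ih
    by_cases hex : ∃ (q : Fin n) (c : Fin n), (q : ℕ) = r ∧ Y q c ≠ 0 ∧ ∀ b < c, Y q b = 0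
    · obtain ⟨q, c, rfl, hqc, hrow⟩ := hex
      have hcol : ∀ a < q, Y a c = 0 := fun a ha => by
        by_contra hne
        exact hqc ((hY a ha c hne).2.2 q ha.ne')
      refine ⟨pivot Y q c, hXY.trans (bEquiv_pivot hqc hrow hcol), fun i hi => ?_⟩
      rcases (Nat.lt_succ_iff_lt_or_eq.mp hi) with hlt | heq
      · have hiq : i ≠ q := fun h => by simp [h] at hlt
        have hic := hcol i hlt
        intro j hj
        have hjc : j ≠ c := fun h => hj (by simp [pivot, hiq, h])
        have hYij : Y i j ≠ 0 := by simpa [pivot, hiq, hjc, hic] using hj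
        obtain ⟨h1, h2, h3⟩ := hY i hlt j hYij
        refine ⟨by simp [pivot, hiq, hjc, hic, h1], fun l hl => ?_, fun a ha => ?_⟩
        · simp [pivot, hiq, hic, h2 l hl]
        · simp [pivot, hjc, h3 a ha, h3 q hiq.symm]
      · obtain rfl := Fin.ext heq
        intro j hj
        have hjc : j = c := by
          by_contra h
          exact hj (by simp [pivot, h])
        subst hjc
        exact ⟨by simp [pivot], fun l hl => by simp [pivot, hl],
          fun a ha => by simp [pivot, ha]⟩
    · refine ⟨Y, hXY, fun i hi => ?_⟩
      rcases (Nat.lt_succ_iff_lt_or_eq.mp hi) with hlt | heq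
      · exact hY i hlt
      · intro j hj
        obtain ⟨c, hc, hmin⟩ := WellFounded.has_min (wellFounded_lt (α := Fin n))
          {c | Y i c ≠ 0} ⟨j, hj⟩
        exact absurd ⟨i, c, heq, hc, fun b hb => by
          by_contra hne
          exact hmin b hne hb⟩ hex

/-- Every matrix is `B`-equivalent to a unique sub-permutation (0,1)-matrix. -/
theorem unique_subperm_zeroOne_B_equivalent (hn : 2 ≤ n)
    (X : Matrix (Fin n) (Fin n) F) :
    ∃! Y : Matrix (Fin n) (Fin n) F, (SubPerm Y ∧ ZeroOne Y) ∧
      ∃ h k : Matrix (Fin n) (Fin n) F, InB h ∧ InB k ∧ Y = hᵀ * X * k := by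
  obtain ⟨Y, hXY, hY⟩ := exists_bEquiv_rowReduced X n
  have hsub : SubPerm Y := by
    refine ⟨fun i j k hj hk => ?_, fun i j k hi hj => ?_⟩
    · by_contra hne
      exact hk ((hY i i.isLt j hj).2.1 k (Ne.symm hne))
    · by_contra hne
      exact hj ((hY i i.isLt k hi).2.2 j (Ne.symm hne))
  have hzo : ZeroOne Y := fun i j => by
    by_cases hij : Y i j = 0
    · exact Or.inl hij
    · exact Or.inr (hY i i.isLt j hij).1
  refine ⟨Y, ⟨⟨hsub, hzo⟩, hXY⟩, fun Z ⟨⟨hZ, hZ'⟩, hXZ⟩ => ?_⟩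
  exact eq_of_bEquiv hZ hZ' hsub hzo (BEquiv.trans (BEquiv.symm hXZ) hXY)
end

section
/- Suppose the characteristic of the field F is not 2. Then two symmetric n×n matrices over F are U-congruent if and only if they are U-equivalent. -/
open Matrix

variable {F : Type*} [Field F] {n : ℕ}

/-- Membership in `U`: upper triangular matrices with all diagonal entries 1. -/
def InU (h : Matrix (Fin n) (Fin n) F) : Prop :=
  (∀ i, h i i = 1) ∧ ∀ i j : Fin n, j < i → h i j = 0

/-- Modulo any power of `X - 1`, the polynomial `X` has a square root with value 1 at 1. -/
theorem exists_polynomial_sq_sub_X_dvd (hchar : (2 : F) ≠ 0) (k : ℕ) :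
    ∃ q r : Polynomial F, q.eval 1 = 1 ∧
      q ^ 2 = Polynomial.X + (Polynomial.X - Polynomial.C 1) ^ (k + 1) * r := by
  induction k with
  | zero => exact ⟨1, -1, by simp, by simp⟩
  | succ k ih =>
    obtain ⟨q, r, hq, hr⟩ := ih
    obtain ⟨s, hs⟩ : Polynomial.X - Polynomial.C 1 ∣ q - 1 :=
      Polynomial.dvd_iff_isRoot.mpr (by simp [hq])
    have hc : (2 : Polynomial F) * Polynomial.C 2⁻¹ = 1 := by
      rw [← Polynomial.C_ofNat, ← Polynomial.C_mul]
      simp [hchar]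
    generalize Polynomial.C (2⁻¹ : F) = c at hc
    refine ⟨q - (Polynomial.X - Polynomial.C 1) ^ (k + 1) * r * c,
      -(s * r) + (Polynomial.X - Polynomial.C 1) ^ k * (r * c) ^ 2, by simp [hq], ?_⟩
    have hq' : q = 1 + (Polynomial.X - Polynomial.C 1) * s := by rw [← hs]; ring
    generalize Polynomial.X - Polynomial.C (1 : F) = t at *
    linear_combination hr - q * t ^ (k + 1) * r * hc - t ^ (k + 1) * r * hq'

namespace InU

theorem blockTriangular {h : Matrix (Fin n) (Fin n) F} (hh : InU h) : h.BlockTriangular id :=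
  fun i j hij => hh.2 i j hij

end InU

theorem Matrix.BlockTriangular.mul_apply_diag {A B : Matrix (Fin n) (Fin n) F}
    (hA : A.BlockTriangular id) (hB : B.BlockTriangular id) (i : Fin n) :
    (A * B) i i = A i i * B i i := by
  rw [Matrix.mul_apply, Finset.sum_eq_single i _ (by simp)]
  intro j _ hj
  rcases lt_or_gt_of_ne hj with hji | hij
  · rw [hA hji, zero_mul]
  · rw [hB hij, mul_zero]

namespace InU

theorem mul {h k : Matrix (Fin n) (Fin n) F} (hh : InU h) (hk : InU k) : InU (h * k) :=
  ⟨fun i => by rw [hh.blockTriangular.mul_apply_diag hk.blockTriangular, hh.1, hk.1, one_mul],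
    fun _ _ hij => hh.blockTriangular.mul hk.blockTriangular hij⟩

theorem isUnit_det {h : Matrix (Fin n) (Fin n) F} (hh : InU h) : IsUnit h.det := by
  simp [Matrix.det_of_isUpperTriangular hh.blockTriangular, hh.1]

theorem inv {h : Matrix (Fin n) (Fin n) F} (hh : InU h) : InU h⁻¹ := by
  let _ := h.invertibleOfIsUnitDet hh.isUnit_det
  have hb := Matrix.blockTriangular_inv_of_blockTriangular hh.blockTriangular
  refine ⟨fun i => ?_, fun _ _ hij => hb hij⟩
  have := hh.blockTriangular.mul_apply_diag hb i
  rw [Matrix.mul_nonsing_inv _ hh.isUnit_det, hh.1, one_mul, Matrix.one_apply_eq] at this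
  exact this.symm

theorem sub_one_pow {u : Matrix (Fin n) (Fin n) F} (hu : InU u) : (u - 1) ^ n = 0 := by
  have := Matrix.aeval_self_charpoly u
  rw [Matrix.charpoly_of_isUpperTriangular u hu.blockTriangular] at this
  simpa [hu.1] using this

theorem aeval_blockTriangular_and_diag {u : Matrix (Fin n) (Fin n) F} (hu : InU u)
    (p : Polynomial F) :
    (Polynomial.aeval u p).BlockTriangular id ∧
      ∀ i, Polynomial.aeval u p i i = p.eval 1 := by
  induction p using Polynomial.induction_on with
  | C a =>
    rw [Polynomial.aeval_C, Matrix.algebraMap_eq_diagonal]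
    exact ⟨Matrix.blockTriangular_diagonal _, fun i => by simp⟩
  | add p q hp hq =>
    rw [map_add]
    exact ⟨hp.1.add hq.1, fun i => by simp [hp.2, hq.2]⟩
  | monomial k a ih =>
    rw [pow_succ, ← mul_assoc, map_mul, Polynomial.aeval_X]
    refine ⟨ih.1.mul hu.blockTriangular, fun i => ?_⟩
    rw [ih.1.mul_apply_diag hu.blockTriangular, ih.2, hu.1]
    simp

theorem aeval {u : Matrix (Fin n) (Fin n) F} (hu : InU u) {p : Polynomial F}
    (hp : p.eval 1 = 1) : InU (Polynomial.aeval u p) :=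
  ⟨fun i => ((hu.aeval_blockTriangular_and_diag p).2 i).trans hp,
    fun _ _ hij => (hu.aeval_blockTriangular_and_diag p).1 hij⟩

/-- A matrix in `U` has a square root in `U` which is a polynomial in it. -/
theorem exists_sqrt (hchar : (2 : F) ≠ 0) {u : Matrix (Fin n) (Fin n) F} (hu : InU u) :
    ∃ p : Polynomial F, InU (Polynomial.aeval u p) ∧ Polynomial.aeval u p ^ 2 = u := by
  obtain ⟨q, r, hq, hr⟩ := exists_polynomial_sq_sub_X_dvd hchar n
  refine ⟨q, hu.aeval hq, ?_⟩
  rw [← map_pow, hr]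
  simp [pow_succ, hu.sub_one_pow]

end InU

theorem Matrix.mul_aeval_eq_transpose_aeval_mul {Z u : Matrix (Fin n) (Fin n) F}
    (h : Z * u = uᵀ * Z) (p : Polynomial F) :
    Z * Polynomial.aeval u p = (Polynomial.aeval u p)ᵀ * Z := by
  induction p using Polynomial.induction_on with
  | C a => simp [Polynomial.aeval_C, Algebra.algebraMap_eq_smul_one]
  | add p q hp hq => simp only [map_add, mul_add, hp, hq, Matrix.transpose_add, add_mul]
  | monomial k a ih =>
    have hcomm : Polynomial.aeval u (Polynomial.C a * Polynomial.X ^ (k + 1)) =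
        u * Polynomial.aeval u (Polynomial.C a * Polynomial.X ^ k) := by
      rw [pow_succ', mul_left_comm, map_mul, Polynomial.aeval_X]
    have hcomm' : Polynomial.aeval u (Polynomial.C a * Polynomial.X ^ (k + 1)) =
        Polynomial.aeval u (Polynomial.C a * Polynomial.X ^ k) * u := by
      rw [pow_succ, ← mul_assoc, map_mul, Polynomial.aeval_X]
    rw [hcomm', ← mul_assoc, ih, mul_assoc, h, ← mul_assoc, ← Matrix.transpose_mul, ← hcomm,
      hcomm']

/-- If `char F ≠ 2`, two symmetric matrices are `U`-congruent iff they are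
`U`-equivalent. -/
theorem symm_U_congruent_iff_U_equivalent (hn : 2 ≤ n) (hchar : (2 : F) ≠ 0)
    (X Y : Matrix (Fin n) (Fin n) F) (hX : X.IsSymm) (hY : Y.IsSymm) :
    (∃ h : Matrix (Fin n) (Fin n) F, InU h ∧ Y = hᵀ * X * h) ↔
      (∃ h k : Matrix (Fin n) (Fin n) F, InU h ∧ InU k ∧ Y = hᵀ * X * k) := by
  constructor
  · rintro ⟨h, hh, hY'⟩
    exact ⟨h, h, hh, hh, hY'⟩
  · rintro ⟨h, k, hh, hk, hY'⟩
    obtain ⟨p, hv, hsq⟩ := (hh.inv.mul hk).exists_sqrt hchar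
    have hZ : (hᵀ * X * h)ᵀ = hᵀ * X * h := by
      simp [Matrix.transpose_mul, hX.eq, mul_assoc]
    have hYZ : Y = hᵀ * X * h * (h⁻¹ * k) := by
      rw [← mul_assoc, Matrix.mul_nonsing_inv_cancel_right _ _ hh.isUnit_det, hY']
    have hself : hᵀ * X * h * (h⁻¹ * k) = (h⁻¹ * k)ᵀ * (hᵀ * X * h) := by
      rw [← hYZ, ← hY.eq, hYZ, Matrix.transpose_mul, hZ]
    have hpoly := Matrix.mul_aeval_eq_transpose_aeval_mul hself p
    generalize Polynomial.aeval (h⁻¹ * k) p = v at *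
    refine ⟨h * v, hh.mul hv, ?_⟩
    calc Y = hᵀ * X * h * v * v := by rw [hYZ, mul_assoc _ v v, ← sq, hsq]
      _ = (h * v)ᵀ * X * (h * v) := by
        rw [hpoly, Matrix.transpose_mul]
        simp only [mul_assoc]
end

section
/- Suppose the characteristic of the field F is not 2 and every element of F is a square. Then two symmetric n×n matrices over F are B-congruent if and only if they are B-equivalent. -/
open Matrix

variable {F : Type*} [Field F] {n : ℕ}

open Polynomial in
/-- If every element of a field of characteristic not two is a square, then `X` is a square modulo
any product of linear factors with nonzero roots. -/
theorem exists_prod_X_sub_C_dvd_sq_sub_X {ι : Type*} (hchar : (2 : F) ≠ 0)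
    (hsq : ∀ a : F, ∃ b : F, b ^ 2 = a) (s : Finset ι) (a : ι → F) (ha : ∀ i ∈ s, a i ≠ 0) :
    ∃ p : F[X], ∏ i ∈ s, (X - C (a i)) ∣ p ^ 2 - X := by
  classical
  induction s using Finset.induction_on with
  | empty => exact ⟨0, by simp⟩
  | insert j s hj ih =>
    obtain ⟨p, r, hr⟩ := ih fun i hi => ha i (Finset.mem_insert_of_mem hi)
    set q := ∏ i ∈ s, (X - C (a i))
    have haj : a j ≠ 0 := ha j (Finset.mem_insert_self j s)
    have hev : p.eval (a j) ^ 2 - a j = q.eval (a j) * r.eval (a j) := by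
      simpa using congrArg (eval (a j)) hr
    obtain ⟨c, hc⟩ : ∃ c : F,
        r.eval (a j) + 2 * c * p.eval (a j) + c ^ 2 * q.eval (a j) = 0 := by
      by_cases hq : q.eval (a j) = 0
      · have hp : p.eval (a j) ≠ 0 := by
          intro hp
          simp [hp, hq, haj] at hev
        refine ⟨-r.eval (a j) / (2 * p.eval (a j)), ?_⟩
        rw [hq]
        field_simp
        ring
      · obtain ⟨b, hb⟩ := hsq (a j)
        refine ⟨(b - p.eval (a j)) / q.eval (a j), ?_⟩
        field_simp
        linear_combination hb - hev
    refine ⟨p + C c * q, ?_⟩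
    have hfac : (p + C c * q) ^ 2 - X = (r + 2 * C c * p + C c ^ 2 * q) * q := by
      linear_combination hr
    rw [Finset.prod_insert hj, hfac]
    refine mul_dvd_mul_right (dvd_iff_isRoot.2 ?_) q
    simpa [IsRoot] using hc

theorem inB_iff {h : Matrix (Fin n) (Fin n) F} : InB h ↔ IsUnit h.det ∧ h.BlockTriangular id :=
  Iff.rfl

theorem Matrix.BlockTriangular.aeval {g : Matrix (Fin n) (Fin n) F} (hg : g.BlockTriangular id)
    (p : Polynomial F) : (Polynomial.aeval g p).BlockTriangular id := by
  have hpow (k : ℕ) : (g ^ k).BlockTriangular id := by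
    induction k with
    | zero => simpa using blockTriangular_one
    | succ k ih => rw [pow_succ]; exact ih.mul hg
  induction p using Polynomial.induction_on' with
  | add p q hp hq => rw [map_add]; exact hp.add hq
  | monomial k c =>
    intro i j hij
    simp [Polynomial.aeval_monomial, ← Algebra.smul_def, hpow k hij]

theorem Matrix.transpose_aeval_mul_of_transpose_mul {g A : Matrix (Fin n) (Fin n) F}
    (hA : gᵀ * A = A * g) (p : Polynomial F) :
    (Polynomial.aeval g p)ᵀ * A = A * Polynomial.aeval g p := by
  induction p using Polynomial.induction_on' with
  | add p q hp hq => rw [map_add, transpose_add, add_mul, mul_add, hp, hq]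
  | monomial k c =>
    have hpow : gᵀ ^ k * A = A * g ^ k :=
      ((show SemiconjBy A g gᵀ from hA.symm).pow_right k).eq.symm
    simp [Polynomial.aeval_monomial, ← Algebra.smul_def, hpow]

/-- Every element of `B` has a square root in `B` that is a polynomial in it. -/
theorem InB.exists_aeval_sq_eq (hchar : (2 : F) ≠ 0) (hsq : ∀ a : F, ∃ b : F, b ^ 2 = a)
    {g : Matrix (Fin n) (Fin n) F} (hg : InB g) :
    ∃ p : Polynomial F, InB (Polynomial.aeval g p) ∧ Polynomial.aeval g p ^ 2 = g := by
  have htri := (inB_iff.1 hg).2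
  have hdiag : ∀ i ∈ Finset.univ, g i i ≠ 0 := by
    have hdet := hg.1.ne_zero
    rw [det_of_isUpperTriangular htri] at hdet
    exact Finset.prod_ne_zero_iff.1 hdet
  obtain ⟨p, hp⟩ := exists_prod_X_sub_C_dvd_sq_sub_X hchar hsq Finset.univ (fun i => g i i) hdiag
  rw [← charpoly_of_isUpperTriangular g htri] at hp
  have hroot : Polynomial.aeval g p ^ 2 = g := by
    have := Polynomial.aeval_eq_zero_of_dvd_aeval_eq_zero hp (aeval_self_charpoly g)
    simpa [sub_eq_zero] using this
  refine ⟨p, inB_iff.2 ⟨?_, htri.aeval p⟩, hroot⟩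
  have hdet := hg.1
  rw [← hroot, det_pow] at hdet
  exact (isUnit_pow_iff two_ne_zero).1 hdet

/-- If `char F ≠ 2` and every element of `F` is a square, two symmetric matrices are
`B`-congruent iff they are `B`-equivalent. -/
theorem symm_B_congruent_iff_B_equivalent (hn : 2 ≤ n) (hchar : (2 : F) ≠ 0)
    (hsq : ∀ a : F, ∃ b : F, b ^ 2 = a)
    (X Y : Matrix (Fin n) (Fin n) F) (hX : X.IsSymm) (hY : Y.IsSymm) :
    (∃ h : Matrix (Fin n) (Fin n) F, InB h ∧ Y = hᵀ * X * h) ↔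
      (∃ h k : Matrix (Fin n) (Fin n) F, InB h ∧ InB k ∧ Y = hᵀ * X * k) := by
  refine ⟨fun ⟨h, hh, e⟩ => ⟨h, h, hh, hh, e⟩, fun ⟨h, k, hh, hk, e⟩ => ?_⟩
  have hkk : k * k⁻¹ = 1 := mul_nonsing_inv k hk.1
  have hkk' : k⁻¹ * k = 1 := nonsing_inv_mul k hk.1
  have hg : (h * k⁻¹)ᵀ * X = k⁻¹ᵀ * Y * k⁻¹ := by
    rw [e, transpose_mul]
    simp only [Matrix.mul_assoc, hkk, Matrix.mul_one]
  have hcomm : (h * k⁻¹)ᵀ * X = X * (h * k⁻¹) := by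
    have := congrArg transpose hg
    simp only [transpose_mul, transpose_transpose, hX.eq, hY.eq] at this
    rw [hg, this, Matrix.mul_assoc]
  obtain ⟨p, hf, hsqrt⟩ := (hh.mul hk.inv).exists_aeval_sq_eq hchar hsq
  have hfX := transpose_aeval_mul_of_transpose_mul hcomm p
  set f := Polynomial.aeval (h * k⁻¹) p
  refine ⟨f * k, hf.mul hk, ?_⟩
  calc Y = (k⁻¹ * k)ᵀ * Y * (k⁻¹ * k) := by simp [hkk']
    _ = kᵀ * (k⁻¹ᵀ * Y * k⁻¹) * k := by simp only [transpose_mul, Matrix.mul_assoc]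
    _ = kᵀ * (X * f ^ 2) * k := by rw [← hg, hcomm, hsqrt]
    _ = kᵀ * (fᵀ * X * f) * k := by rw [hfX, pow_two, Matrix.mul_assoc X]
    _ = (f * k)ᵀ * X * (f * k) := by simp only [transpose_mul, Matrix.mul_assoc]
end
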